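/- The group of rational points of the elliptic curve E : y² = x³ − x² + x over ℚ is isomorphic to ℤ/4ℤ; in particular it is a cyclic group of order 4 (its Mordell–Weil rank is 0). -/

import Mathlib

/-- Euler: `r⁴ - r²s² + s⁴` is never a square for coprime nonzero `r`, `s` of opposite parity. -/
theorem mul_eq_zero_of_sq_sub_sq_sq_add_mul_sq_eq_sq {r s t : ℤ} (hc : IsCoprime r s)
    (hr : r % 2 = 0) (hs : s % 2 = 1) (h : (r^2-s^2)^2+(r*s)^2 = t^2) : r * s = 0 := by
  induction hN : (r * s).natAbs using Nat.strong_induction_on generalizing r s t with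
  | _ N ih =>
  by_contra hne
  have hr0 : r ≠ 0 := left_ne_zero_of_mul hne
  have hs0 : s ≠ 0 := right_ne_zero_of_mul hne
  obtain ⟨r', rfl⟩ : (2:ℤ) ∣ r := Int.dvd_of_emod_eq_zero hr
  have hodd : ((2*r')^2-s^2) % 2 = 1 := by
    obtain ⟨k, rfl⟩ : ∃ k, s = 2*k+1 := ⟨s/2, by omega⟩
    ring_nf; omega
  have hcop : IsCoprime ((2*r')^2-s^2) (2*r'*s) := by
    apply IsCoprime.mul_right
    · rw [show (2*r')^2-s^2 = -s^2 + 2*r' * (2*r') by ring]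
      exact hc.symm.pow_left.neg_left.add_mul_right_left _
    · rw [show (2*r')^2-s^2 = (2*r')^2 + (-s) * s by ring]
      exact hc.pow_left.add_mul_right_left _
  have ht : 0 < |t| := by
    rw [abs_pos]
    rintro rfl
    have := sq_nonneg ((2*r')^2-s^2)
    have : 0 < (2*r'*s)^2 := by positivity
    nlinarith
  have hp : PythagoreanTriple ((2*r')^2-s^2) (2*r'*s) |t| := by
    unfold PythagoreanTriple; rw [abs_mul_abs_self]; linarith
  obtain ⟨m, n, h1, h2, -, hmn, -, -⟩ :=
    hp.coprime_classification' (Int.isCoprime_iff_gcd_eq_one.1 hcop) hodd ht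
  have h2' : r' * s = m * n := by linarith
  obtain ⟨a, b, ⟨c, rfl⟩, ⟨d, rfl⟩, rfl⟩ := exists_dvd_and_dvd_of_dvd_mul (Dvd.intro s h2')
  have hab : a * b ≠ 0 := by rintro h; simp [h] at hr0
  obtain rfl : s = c * d := mul_left_cancel₀ hab (by linarith)
  rw [← Int.isCoprime_iff_gcd_eq_one] at hmn
  have hbc : IsCoprime (b^2) (c^2) := (hmn.symm.of_mul_left_left.of_mul_right_right).pow
  have had2 : IsCoprime (2*a) d := hc.of_mul_right_right.of_isCoprime_of_dvd_left ⟨b, by ring⟩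
  have had : IsCoprime a d := had2.of_mul_left_right
  have key : b^2*(4*a^2+d^2) = c^2*(a^2+d^2) := by linarith
  obtain ⟨k, hk⟩ : b^2 ∣ a^2+d^2 := hbc.dvd_of_dvd_mul_left ⟨_, key.symm⟩
  have hb0 : b ≠ 0 := right_ne_zero_of_mul hab
  have ha0 : a ≠ 0 := left_ne_zero_of_mul hab
  have hc0 : c ≠ 0 := left_ne_zero_of_mul hs0
  have hd0 : d ≠ 0 := right_ne_zero_of_mul hs0
  have hk' : 4*a^2+d^2 = c^2*k := by
    apply mul_left_cancel₀ (pow_ne_zero 2 hb0); rw [key, hk]; ring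
  have hkpos : 0 < k := by
    have : 0 < b^2*k := by rw [← hk]; positivity
    exact pos_of_mul_pos_right this (sq_nonneg b)
  have hk3 : k ∣ 3 := by
    obtain ⟨u, v, huv⟩ := (had.pow : IsCoprime (a^2) (d^2))
    exact ⟨u*(c^2-b^2)+v*(4*b^2-c^2), by linear_combination (-3)*huv + (u-v)*(hk'-hk)+ 3*v*hk⟩
  have hk1 : k = 1 := by
    have := Int.le_of_dvd (by norm_num) hk3
    interval_cases k
    · rfl
    · omega
    · exfalso
      have h3 : (a^2+d^2) % 3 = 0 := by omega
      have : a % 3 = 0 ∧ d % 3 = 0 := by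
        have ha : a % 3 = 0 ∨ a % 3 = 1 ∨ a % 3 = 2 := by omega
        have hd : d % 3 = 0 ∨ d % 3 = 1 ∨ d % 3 = 2 := by omega
        rcases ha with ha | ha | ha <;> rcases hd with hd | hd | hd <;>
          simp [pow_two, Int.add_emod, Int.mul_emod, ha, hd] at h3 ⊢
      have := had.isUnit_of_dvd' (Int.dvd_of_emod_eq_zero this.1) (Int.dvd_of_emod_eq_zero this.2)
      norm_num [Int.isUnit_iff] at this
  subst hk1
  have hdodd : d % 2 = 1 := by
    rcases Int.emod_two_eq_zero_or_one d with h | h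
    · simp [Int.mul_emod, h] at hs
    · exact h
  have hq : PythagoreanTriple d (2*a) |c| := by
    unfold PythagoreanTriple; rw [abs_mul_abs_self]; linarith
  obtain ⟨u, v, e1, e2, -, huv, hpar, -⟩ :=
    hq.coprime_classification' (Int.isCoprime_iff_gcd_eq_one.1 had2.symm) hdodd (abs_pos.2 hc0)
  rw [← Int.isCoprime_iff_gcd_eq_one] at huv
  have e3 : a = u * v := by linarith
  have hlt : (u*v).natAbs < N := by
    rw [← e3, ← hN, show 2*(a*b)*(c*d) = a * (2*b*c*d) by ring, Int.natAbs_mul]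
    have h1 : 0 < a.natAbs := Int.natAbs_pos.2 ha0
    have h2 : 0 < (b*c*d).natAbs := Int.natAbs_pos.2 (by positivity)
    have h3 : (2*b*c*d).natAbs = 2 * (b*c*d).natAbs := by
      rw [show 2*b*c*d = 2*(b*c*d) by ring, Int.natAbs_mul]; rfl
    rw [h3]; nlinarith
  have heq : (u^2-v^2)^2+(u*v)^2 = b^2 := by rw [← e1, ← e3]; linarith
  rcases hpar with ⟨hu, hv⟩ | ⟨hu, hv⟩
  · exact ha0 (e3.trans (ih _ hlt huv hu hv heq rfl))
  · refine ha0 (e3.trans ?_)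
    rw [mul_comm] at hlt ⊢
    exact ih _ hlt huv.symm hv hu (t := b) (by linarith) rfl

theorem sq_eq_sq_of_sq_sub_sq_sq_add_mul_sq_eq_sq {r s t : ℤ} (hc : IsCoprime r s)
    (h0 : r * s ≠ 0) (h : (r^2-s^2)^2+(r*s)^2 = t^2) : r^2 = s^2 := by
  rcases Int.emod_two_eq_zero_or_one r with hr | hr <;>
    rcases Int.emod_two_eq_zero_or_one s with hs | hs
  · have := hc.isUnit_of_dvd' (Int.dvd_of_emod_eq_zero hr) (Int.dvd_of_emod_eq_zero hs)
    norm_num [Int.isUnit_iff] at this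
  · exact absurd (mul_eq_zero_of_sq_sub_sq_sq_add_mul_sq_eq_sq hc hr hs h) h0
  · refine absurd ?_ h0
    rw [mul_comm]
    exact mul_eq_zero_of_sq_sub_sq_sq_add_mul_sq_eq_sq hc.symm hs hr (t := t) (by linarith)
  · have hcop : IsCoprime (r*s) (r^2-s^2) := by
      apply IsCoprime.mul_left
      · rw [show r^2-s^2 = -s^2 + r * r by ring]
        exact hc.pow_right.neg_right.add_mul_left_right _
      · rw [show r^2-s^2 = r^2 + s * (-s) by ring]
        exact hc.symm.pow_right.add_mul_left_right _
    have ht : 0 < |t| := by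
      rw [abs_pos]
      rintro rfl
      have := sq_nonneg (r^2-s^2)
      have : 0 < (r*s)^2 := by positivity
      nlinarith
    have hp : PythagoreanTriple (r*s) (r^2-s^2) |t| := by
      unfold PythagoreanTriple
      rw [abs_mul_abs_self]
      linarith
    obtain ⟨m, n, h1, h2, -, hmn, hpar, -⟩ := hp.coprime_classification'
      (Int.isCoprime_iff_gcd_eq_one.1 hcop) (by simp [Int.mul_emod, hr, hs]) ht
    rw [← Int.isCoprime_iff_gcd_eq_one] at hmn
    obtain ⟨w, hw⟩ : (2:ℤ) ∣ r^2+s^2 := by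
      apply Int.dvd_of_emod_eq_zero
      simp [pow_two, Int.add_emod, Int.mul_emod, hr, hs]
    have heq : (m^2-n^2)^2+(m*n)^2 = w^2 := by
      have : 4*((m^2-n^2)^2+(m*n)^2) = 4*w^2 := by
        linear_combination (-4)*(m^2-n^2+r*s)*h1 - (r^2-s^2+2*m*n)*h2 + (r^2+s^2+2*w)*hw
      linarith
    have hmn0 : m * n = 0 := by
      rcases hpar with ⟨hm, hn⟩ | ⟨hm, hn⟩
      · exact mul_eq_zero_of_sq_sub_sq_sq_add_mul_sq_eq_sq hmn hm hn heq
      · rw [mul_comm]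
        exact mul_eq_zero_of_sq_sub_sq_sq_add_mul_sq_eq_sq hmn.symm hn hm (t := w) (by linarith)
    linarith

theorem Int.exists_sq_of_isCoprime_of_pos {a b c : ℤ} (hc : IsCoprime a b) (ha : 0 < a)
    (h : a * b = c^2) : ∃ d, a = d^2 := by
  obtain ⟨d, hd | hd⟩ := Int.sq_of_isCoprime hc h
  · exact ⟨d, hd⟩
  · nlinarith [sq_nonneg d]

theorem Rat.eq_zero_or_one_of_sq_eq_cube_sub_sq_add_self {x y : ℚ} (h : y^2 = x^3-x^2+x) :
    x = 0 ∨ x = 1 := by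
  by_cases hx : x = 0
  · exact Or.inl hx
  right
  have hxpos : 0 < x := by
    by_contra hneg
    have : x < 0 := lt_of_le_of_ne (not_lt.1 hneg) hx
    nlinarith [sq_nonneg y, sq_nonneg x, mul_pos_of_neg_of_neg this this]
  have ha : 0 < x.num := Rat.num_pos.2 hxpos
  set a := x.num with hadef
  obtain ⟨b, hbdef⟩ : ∃ b : ℤ, b = x.den := ⟨_, rfl⟩
  have hb : 0 < b := by rw [hbdef]; exact_mod_cast x.den_pos
  have hab : IsCoprime a b := by rw [hbdef, hadef]; exact Rat.isCoprime_num_den x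
  have hxab : x = a / b := by rw [hbdef, hadef]; exact_mod_cast (Rat.num_div_den x).symm
  have hbq : (b:ℚ) ≠ 0 := by exact_mod_cast hb.ne'
  have hsq : IsSquare ((a*b*(a^2-a*b+b^2) : ℤ) : ℚ) := by
    refine ⟨y*b^2, ?_⟩
    have : y*b^2*(y*b^2) = y^2*b^4 := by ring
    rw [this, h, hxab]
    push_cast
    field_simp
  obtain ⟨c, hc⟩ := Rat.isSquare_intCast_iff.1 hsq
  rw [← pow_two] at hc
  have hcop : IsCoprime (a*b) (a^2-a*b+b^2) := by
    apply IsCoprime.mul_left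
    · rw [show a^2-a*b+b^2 = b^2 + a * (a-b) by ring]
      exact hab.pow_right.add_mul_left_right _
    · rw [show a^2-a*b+b^2 = a^2 + b * (b-a) by ring]
      exact hab.symm.pow_right.add_mul_left_right _
  have hpos : 0 < a*b := mul_pos ha hb
  obtain ⟨e, he⟩ := Int.exists_sq_of_isCoprime_of_pos hcop hpos hc
  obtain ⟨t, ht⟩ := Int.exists_sq_of_isCoprime_of_pos hcop.symm
    (by nlinarith [sq_nonneg (a-b)]) (by rw [mul_comm]; exact hc)
  obtain ⟨r, hr⟩ := Int.exists_sq_of_isCoprime_of_pos hab ha he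
  obtain ⟨s, hs⟩ := Int.exists_sq_of_isCoprime_of_pos hab.symm hb (by rw [mul_comm]; exact he)
  have hrs : r^2 = s^2 := by
    apply sq_eq_sq_of_sq_sub_sq_sq_add_mul_sq_eq_sq (t := t)
    · rw [hr, hs] at hab
      exact (IsCoprime.pow_iff two_pos two_pos).1 hab
    · rintro h0
      rw [hr, hs, ← mul_pow, h0] at hpos
      simp at hpos
    · rw [← ht, hr, hs]; ring
  rw [hxab, hr, hs, hrs, ← hs, div_self hbq]

open WeierstrassCurve.Affine in
/-- the group of rational points of the elliptic curve `y² = x³ − x² + x`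
over `ℚ` is isomorphic to `ℤ/4ℤ`. -/
theorem mordell_weil_x3_sub_x2_add_x
    (W : WeierstrassCurve.Affine ℚ)
    (hW : W = { a₁ := 0, a₂ := -1, a₃ := 0, a₄ := 1, a₆ := 0 }) :
    Nonempty (W.Point ≃+ ZMod 4) := by
  have hP : W.Nonsingular 1 1 := by
    rw [nonsingular_iff, equation_iff]; subst hW; norm_num
  have hT : W.Nonsingular 0 0 := by
    rw [nonsingular_iff, equation_iff]; subst hW; norm_num
  let P : W.Point := .some _ _ hP
  have h2 : P + P = .some _ _ hT := by
    have hne : (1:ℚ) ≠ W.negY 1 1 := by subst hW; norm_num [negY]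
    rw [Point.add_self_of_Y_ne hne, Point.some.injEq, slope_of_Y_ne rfl hne]
    subst hW
    norm_num [addX, addY, negY, negAddY]
  have h4 : (P + P) + (P + P) = 0 := by
    rw [h2]
    exact Point.add_self_of_Y_eq (by subst hW; norm_num [negY])
  have hord : addOrderOf P = 4 := by
    refine addOrderOf_eq_prime_pow (p := 2) (n := 1) ?_ ?_
    · rw [pow_one, two_nsmul, h2]
      exact Point.some_ne_zero hT
    · rw [show 2 ^ (1+1) = 2 + 2 from rfl, add_nsmul, two_nsmul, h4]
  have hmem (Q : W.Point) : Q ∈ AddSubgroup.zmultiples P := by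
    rcases Q with _ | ⟨x, y, hQ⟩
    · exact zero_mem _
    · have heq : y^2 = x^3-x^2+x := by
        have := (equation_iff ..).1 hQ.1
        subst hW
        linarith
      rcases Rat.eq_zero_or_one_of_sq_eq_cube_sub_sq_add_self heq with rfl | rfl
      · obtain rfl : y = 0 := by simpa using heq
        exact h2 ▸ add_mem (AddSubgroup.mem_zmultiples P) (AddSubgroup.mem_zmultiples P)
      · rcases sq_eq_sq_iff_eq_or_eq_neg.1 (by linarith : y^2 = 1^2) with rfl | rfl
        · exact AddSubgroup.mem_zmultiples P
        · have : Point.some _ _ hQ = -P := by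
            rw [Point.neg_some, Point.some.injEq]
            subst hW
            norm_num [negY]
          exact this ▸ neg_mem (AddSubgroup.mem_zmultiples P)
  have hcard : Nat.card W.Point = 4 := by
    rw [← addOrderOf_eq_card_of_forall_mem_zmultiples hmem, hord]
  exact ⟨(hcard ▸ zmodAddCyclicAddEquiv ⟨P, hmem⟩ : ZMod 4 ≃+ W.Point).symm⟩
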